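/- Let 2 ≤ p < n and set p⋆ := np/(n−p). There exists a constant C = C(n,p) > 0 such that for every D ≥ 1, every k ∈ ℕ ∪ {0} and every radially symmetric ζ ∈ C_c^∞(B_1(0)), one has ∫_{B_1(0)} |∇ζ|^2 dx − ((n−2)/2)^2 ∫_{B_1(0)} |ζ|^2/|x|^2 dx − (1/4) ∫_{B_1(0)} (|ζ|^2/|x|^2) ∑_{i=1}^k Y_i^2(|x|/D) dx ≥ C ( ∫_{B_1(0)} |x|^{p⋆(p−2)/p} Y_{k+1}^{1+p⋆/p}(|x|/D) |ζ|^{2p⋆/p} dx )^{p/p⋆}, where B_1(0) is the open unit ball in ℝ^n. -/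

import Mathlib

open MeasureTheory Real Set

noncomputable def X1 (t : ℝ) : ℝ := (1 - Real.log t)⁻¹

/-- Iterated logarithmic function: `XX 0 t = t`, `XX (k+1) t = X1 (XX k t)`;
so `XX 1 = X_1`, `XX 2 = X_2`, ... of the paper. -/
noncomputable def XX : ℕ → ℝ → ℝ
  | 0, t => t
  | k + 1, t => X1 (XX k t)

/-- `YY k t = ∏_{i=1}^k X_i(t)`, with `YY 0 = 1`. -/
noncomputable def YY (k : ℕ) (t : ℝ) : ℝ := ∏ i ∈ Finset.Icc 1 k, XX i t

/-- `ZZ k t = ∑_{i=1}^k Y_i(t)`, with `ZZ 0 = 0`. -/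
noncomputable def ZZ (k : ℕ) (t : ℝ) : ℝ := ∑ i ∈ Finset.Icc 1 k, YY i t

/-- The quantity `I_k[u; D]` of the paper. -/
noncomputable def Ik (n : ℕ) (p D : ℝ) (Ω : Set (EuclideanSpace ℝ (Fin n))) (k : ℕ)
    (u : EuclideanSpace ℝ (Fin n) → ℝ) : ℝ :=
  (∫ x in Ω, ‖fderiv ℝ u x‖ ^ p)
    - |((n : ℝ) - p) / p| ^ p * ∫ x in Ω, |u x| ^ p / ‖x‖ ^ p
    - ((p - 1) / (2 * p)) * |((n : ℝ) - p) / p| ^ (p - 2) *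
        ∫ x in Ω, (|u x| ^ p / ‖x‖ ^ p) * ∑ i ∈ Finset.Icc 1 k, (YY i (‖x‖ / D)) ^ 2

lemma YY_succ (k : ℕ) (t : ℝ) : YY (k + 1) t = YY k t * XX (k + 1) t := by
  simp [YY, Finset.prod_Icc_succ_top]

lemma ZZ_succ (k : ℕ) (t : ℝ) : ZZ (k + 1) t = ZZ k t + YY (k + 1) t := by
  simp [ZZ, Finset.sum_Icc_succ_top]

lemma XX_mem_Ioc {t : ℝ} (ht : t ∈ Ioc (0 : ℝ) 1) (k : ℕ) : XX k t ∈ Ioc (0 : ℝ) 1 := by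
  induction k with
  | zero => exact ht
  | succ k ih =>
    have hlog : log (XX k t) ≤ 0 := log_nonpos ih.1.le ih.2
    exact ⟨inv_pos.2 (by linarith), inv_le_one_of_one_le₀ (by linarith)⟩

lemma YY_mem_Ioc {t : ℝ} (ht : t ∈ Ioc (0 : ℝ) 1) (k : ℕ) : YY k t ∈ Ioc (0 : ℝ) 1 :=
  ⟨Finset.prod_pos fun i _ => (XX_mem_Ioc ht i).1,
    Finset.prod_le_one (fun i _ => (XX_mem_Ioc ht i).1.le) fun i _ => (XX_mem_Ioc ht i).2⟩

lemma ZZ_mem_Icc {t : ℝ} (ht : t ∈ Ioc (0 : ℝ) 1) (k : ℕ) : ZZ k t ∈ Icc (0 : ℝ) k := by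
  refine ⟨Finset.sum_nonneg fun i _ => (YY_mem_Ioc ht i).1.le, ?_⟩
  simpa [ZZ] using Finset.sum_le_card_nsmul (Finset.Icc 1 k) (fun i => YY i t) 1
    fun i _ => (YY_mem_Ioc ht i).2

lemma sum_YY_sq_mem_Icc {t : ℝ} (ht : t ∈ Ioc (0 : ℝ) 1) (k : ℕ) :
    ∑ i ∈ Finset.Icc 1 k, YY i t ^ 2 ∈ Icc (0 : ℝ) k := by
  refine ⟨Finset.sum_nonneg fun i _ => sq_nonneg _, ?_⟩
  simpa using Finset.sum_le_card_nsmul (Finset.Icc 1 k) (fun i => YY i t ^ 2) 1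
    fun i _ => pow_le_one₀ (YY_mem_Ioc ht i).1.le (YY_mem_Ioc ht i).2

lemma hasDerivAt_XX {t : ℝ} (ht : t ∈ Ioc (0 : ℝ) 1) (k : ℕ) :
    HasDerivAt (XX k) (XX k t * YY k t / t) t := by
  have ht0 : t ≠ 0 := ht.1.ne'
  induction k with
  | zero =>
    have : XX 0 t * YY 0 t / t = 1 := by simp [XX, YY, ht0]
    rw [this]
    exact hasDerivAt_id t
  | succ k ih =>
    have hX := XX_mem_Ioc ht k
    have hlog : log (XX k t) ≤ 0 := log_nonpos hX.1.le hX.2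
    have hX0 : XX k t ≠ 0 := hX.1.ne'
    have hne : 1 - log (XX k t) ≠ 0 := by linarith
    have h := ((ih.log hX0).const_sub 1).inv hne
    refine h.congr_deriv ?_
    rw [YY_succ, show XX (k + 1) t = (1 - log (XX k t))⁻¹ from rfl]
    field_simp

lemma hasDerivAt_YY {t : ℝ} (ht : t ∈ Ioc (0 : ℝ) 1) (k : ℕ) :
    HasDerivAt (YY k) (YY k t * ZZ k t / t) t := by
  induction k with
  | zero =>
    rw [show YY 0 = fun _ => 1 by ext; simp [YY]]
    simpa [ZZ] using hasDerivAt_const t (1 : ℝ)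
  | succ k ih =>
    have h := ih.mul (hasDerivAt_XX ht (k + 1))
    rw [show YY (k + 1) = YY k * XX (k + 1) from funext (YY_succ k)]
    refine h.congr_deriv ?_
    simp only [ZZ_succ, YY_succ, Pi.mul_apply]
    ring

lemma hasDerivAt_ZZ {t : ℝ} (ht : t ∈ Ioc (0 : ℝ) 1) (k : ℕ) :
    HasDerivAt (ZZ k) ((ZZ k t ^ 2 + ∑ i ∈ Finset.Icc 1 k, YY i t ^ 2) / 2 / t) t := by
  induction k with
  | zero =>
    rw [show ZZ 0 = fun _ => 0 by ext; simp [ZZ]]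
    simpa using hasDerivAt_const t (0 : ℝ)
  | succ k ih =>
    have h := ih.add (hasDerivAt_YY ht (k + 1))
    rw [show ZZ (k + 1) = ZZ k + YY (k + 1) from funext (ZZ_succ k)]
    refine h.congr_deriv ?_
    rw [Finset.sum_Icc_succ_top (by omega)]
    simp only [ZZ_succ, Pi.add_apply]
    ring

lemma div_mem_Ioc {r D : ℝ} (hr : r ∈ Ioc (0 : ℝ) 1) (hD : 1 ≤ D) : r / D ∈ Ioc (0 : ℝ) 1 :=
  ⟨div_pos hr.1 (by linarith), (div_le_one (by linarith)).2 (hr.2.trans hD)⟩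

lemma continuousOn_YY_div {D : ℝ} (hD : 1 ≤ D) (k : ℕ) :
    ContinuousOn (fun r => YY k (r / D)) (Ioc 0 1) := fun r hr =>
  ((hasDerivAt_YY (div_mem_Ioc hr hD) k).continuousAt.comp
    (f := fun r => r / D) (by fun_prop)).continuousWithinAt

/-- The logarithmic correction `S` solves the Riccati equation `r S' + S² = -Q / 4`,
where `Q` is the sum of the squares of the `YY i`. -/
lemma riccati_ZZ_add_YY {D : ℝ} (hD : 1 ≤ D) (k : ℕ) {c : ℝ} (hc : c ^ 2 = c) {r : ℝ}
    (hr : r ∈ Ioc (0 : ℝ) 1) :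
    HasDerivAt (fun r => -(ZZ k (r / D) / 2 + c * YY (k + 1) (r / D)))
      ((-(∑ i ∈ Finset.Icc 1 k, YY i (r / D) ^ 2) / 4
        - (-(ZZ k (r / D) / 2 + c * YY (k + 1) (r / D))) ^ 2) / r) r := by
  have ht := div_mem_Ioc hr hD
  have hD0 : D ≠ 0 := by linarith
  have hr0 : r ≠ 0 := hr.1.ne'
  have hd : HasDerivAt (fun r : ℝ => r / D) (1 / D) r := (hasDerivAt_id r).div_const D
  have h := (((hasDerivAt_ZZ ht k).comp r hd).div_const 2).add
    (((hasDerivAt_YY ht (k + 1)).comp r hd).const_mul c) |>.neg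
  refine h.congr_deriv ?_
  rw [ZZ_succ]
  field_simp
  linear_combination (16 * YY (k + 1) (r / D) ^ 2) * hc

/-- A weighted ground-state inequality on an interval touching the origin. -/
lemma sub_le_integral_of_riccati (m : ℕ) {f f' S Q : ℝ → ℝ} {M a b : ℝ}
    (hf : ∀ r, HasDerivAt f (f' r) r) (ha : 0 ≤ a) (hab : a ≤ b) (hb : b ≤ 1)
    (hS : ∀ r ∈ Ioc (0 : ℝ) 1, HasDerivAt S ((-Q r / 4 - S r ^ 2) / r) r)
    (hM : ∀ r ∈ Ioc (0 : ℝ) 1, |S r| ≤ M)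
    (hint : IntegrableOn
      (fun r => r ^ (m + 2) * f' r ^ 2 - r ^ m * f r ^ 2 * (((m : ℝ) + 1) ^ 2 / 4 + Q r / 4))
      (Icc a b)) :
    b ^ (m + 1) * (f b ^ 2 * (S b - (m + 1) / 2)) - a ^ (m + 1) * (f a ^ 2 * (S a - (m + 1) / 2))
      ≤ ∫ r in a..b,
        (r ^ (m + 2) * f' r ^ 2 - r ^ m * f r ^ 2 * (((m : ℝ) + 1) ^ 2 / 4 + Q r / 4)) := by
  have hfc : Continuous f := continuous_iff_continuousAt.2 fun r => (hf r).continuousAt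
  have hder : ∀ r ∈ Ioc (0 : ℝ) 1, HasDerivAt
      (fun r => r ^ (m + 1) * (f r ^ 2 * (S r - ((m : ℝ) + 1) / 2)))
      ((m + 1) * r ^ m * (f r ^ 2 * (S r - ((m : ℝ) + 1) / 2)) +
        r ^ (m + 1) * (2 * f r * f' r * (S r - ((m : ℝ) + 1) / 2)
          + f r ^ 2 * ((-Q r / 4 - S r ^ 2) / r))) r := by
    intro r hr
    refine ((hasDerivAt_pow (m + 1) r).mul
      (((hf r).pow 2).mul ((hS r hr).sub_const (((m : ℝ) + 1) / 2)))).congr_deriv ?_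
    simp
  refine intervalIntegral.sub_le_integral_of_hasDeriv_right_of_le
    (g := fun r => r ^ (m + 1) * (f r ^ 2 * (S r - ((m : ℝ) + 1) / 2))) hab ?_
    (fun r hr => (hder r ⟨ha.trans_lt hr.1, (hr.2.trans_le hb).le⟩).hasDerivWithinAt) hint ?_
  · intro r hr
    rcases (ha.trans hr.1).eq_or_lt with rfl | h0
    · have hlim : Filter.Tendsto (fun r : ℝ => r ^ (m + 1) * (f r ^ 2 * (M + ((m : ℝ) + 1) / 2)))
          (nhdsWithin 0 (Icc a b)) (nhds 0) := by
        have hc : Continuous fun r : ℝ => r ^ (m + 1) * (f r ^ 2 * (M + ((m : ℝ) + 1) / 2)) := by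
          fun_prop
        simpa [ContinuousWithinAt] using hc.continuousWithinAt (s := Icc a b) (x := 0)
      have hz : ContinuousWithinAt (fun r => r ^ (m + 1) * (f r ^ 2 * (S r - ((m : ℝ) + 1) / 2)))
          (Icc a b) 0 := by
        rw [ContinuousWithinAt]
        simp only [ne_eq, Nat.add_eq_zero_iff, one_ne_zero, and_false, not_false_eq_true,
          zero_pow, zero_mul]
        refine squeeze_zero_norm' ?_ hlim
        filter_upwards [self_mem_nhdsWithin] with r hr
        rcases (ha.trans hr.1).eq_or_lt with rfl | h0
        · simp
        · have hSM := abs_le.1 (hM r ⟨h0, hr.2.trans hb⟩)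
          have hSM' : |S r - ((m : ℝ) + 1) / 2| ≤ M + ((m : ℝ) + 1) / 2 :=
            abs_le.2 ⟨by linarith, by linarith [Nat.cast_nonneg (α := ℝ) m]⟩
          rw [norm_eq_abs, abs_mul, abs_mul, abs_of_nonneg (pow_nonneg h0.le _),
            abs_of_nonneg (sq_nonneg (f r))]
          gcongr
      exact hz
    · exact (hder r ⟨h0, hr.2.trans hb⟩).continuousAt.continuousWithinAt
  · intro r hr
    have h0 : 0 < r := ha.trans_lt hr.1
    have key : r ^ (m + 2) * f' r ^ 2 - r ^ m * f r ^ 2 * (((m : ℝ) + 1) ^ 2 / 4 + Q r / 4)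
      - ((m + 1) * r ^ m * (f r ^ 2 * (S r - ((m : ℝ) + 1) / 2)) +
        r ^ (m + 1) * (2 * f r * f' r * (S r - ((m : ℝ) + 1) / 2)
          + f r ^ 2 * ((-Q r / 4 - S r ^ 2) / r)))
      = r ^ m * (r * f' r - (S r - ((m : ℝ) + 1) / 2) * f r) ^ 2 := by
      field_simp
      ring
    have : 0 ≤ r ^ m * (r * f' r - (S r - ((m : ℝ) + 1) / 2) * f r) ^ 2 := by positivity
    linarith

lemma integrableOn_Icc_of_bounded {g : ℝ → ℝ} {M : ℝ} (hg : ContinuousOn g (Ioc 0 1))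
    (hM : ∀ r ∈ Ioc (0 : ℝ) 1, |g r| ≤ M) : IntegrableOn g (Icc 0 1) := by
  rw [integrableOn_Icc_iff_integrableOn_Ioc]
  exact Integrable.of_bound (hg.aestronglyMeasurable measurableSet_Ioc) M
    ((ae_restrict_iff' measurableSet_Ioc).2 (.of_forall hM))

lemma setIntegral_ball_fun_norm (m : ℕ) (g : ℝ → ℝ) :
    ∫ x in Metric.ball (0 : EuclideanSpace ℝ (Fin (m + 3))) 1, g ‖x‖ =
      ((m + 3) * volume.real (Metric.ball (0 : EuclideanSpace ℝ (Fin (m + 3))) 1)) *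
        ∫ r in (0 : ℝ)..1, r ^ (m + 2) * g r := by
  have h1 : (Metric.ball (0 : EuclideanSpace ℝ (Fin (m + 3))) 1).indicator (fun x => g ‖x‖)
      = fun x => (Iio (1 : ℝ)).indicator g ‖x‖ := by
    ext x
    simp [indicator]
  have h2 : (fun r : ℝ => r ^ (m + 2) * (Iio (1 : ℝ)).indicator g r)
      = (Iio (1 : ℝ)).indicator fun r => r ^ (m + 2) * g r := by
    ext r
    simp [indicator]
  rw [← integral_indicator Metric.isOpen_ball.measurableSet, h1,
    integral_fun_norm_addHaar volume ((Iio (1 : ℝ)).indicator g)]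
  simp only [finrank_euclideanSpace, Fintype.card_fin, nsmul_eq_mul, smul_eq_mul,
    show m + 3 - 1 = m + 2 from rfl]
  rw [h2, setIntegral_indicator measurableSet_Iio, Ioi_inter_Iio,
    intervalIntegral.integral_of_le zero_le_one, integral_Ioc_eq_integral_Ioo]
  push_cast
  ring

lemma norm_fderiv_of_eq_comp_norm {E : Type*} [NormedAddCommGroup E] [InnerProductSpace ℝ E]
    [Nontrivial E] {ζ : E → ℝ} {f : ℝ → ℝ} (hζ : ∀ x, ζ x = f ‖x‖) (hf : Differentiable ℝ f)
    {x : E} (hx : x ≠ 0) : ‖fderiv ℝ ζ x‖ = |deriv f ‖x‖| := by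
  have hn : DifferentiableAt ℝ (fun x : E => ‖x‖) x := differentiableAt_id.norm ℝ hx
  have h : HasFDerivAt ζ (deriv f ‖x‖ • fderiv ℝ (fun x : E => ‖x‖) x) x := by
    rw [show ζ = f ∘ fun x => ‖x‖ from funext hζ]
    exact (hf ‖x‖).hasDerivAt.comp_hasFDerivAt x hn.hasFDerivAt
  rw [h.fderiv, norm_smul, norm_fderiv_norm hn, mul_one, norm_eq_abs]

/-- The radial density of the series-improved `L^2`-Hardy functional in dimension `m + 3`. -/
noncomputable def hardyDensity (m : ℕ) (D : ℝ) (k : ℕ) (f f' : ℝ → ℝ) (r : ℝ) : ℝ :=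
  r ^ (m + 2) * f' r ^ 2 - r ^ m * f r ^ 2 *
    (((m : ℝ) + 1) ^ 2 / 4 + (∑ i ∈ Finset.Icc 1 k, YY i (r / D) ^ 2) / 4)

lemma integrableOn_mul_sum_YY_sq {D : ℝ} (hD : 1 ≤ D) (k : ℕ) {g : ℝ → ℝ} (hg : Continuous g) :
    IntegrableOn (fun r => g r * ∑ i ∈ Finset.Icc 1 k, YY i (r / D) ^ 2) (Icc 0 1) := by
  refine IntegrableOn.continuousOn_mul hg.continuousOn (integrableOn_Icc_of_bounded (M := k)
    (continuousOn_finsetSum _ fun i _ => (continuousOn_YY_div hD i).pow 2) fun r hr => ?_)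
    isCompact_Icc
  have h := sum_YY_sq_mem_Icc (div_mem_Ioc hr hD) k
  rw [abs_of_nonneg h.1]
  exact h.2

lemma integrableOn_hardyDensity (m : ℕ) {D : ℝ} (hD : 1 ≤ D) (k : ℕ) {f f' : ℝ → ℝ}
    (hf : Continuous f) (hf' : Continuous f') :
    IntegrableOn (hardyDensity m D k f f') (Icc 0 1) := by
  have h1 : IntegrableOn (fun r => r ^ (m + 2) * f' r ^ 2 - r ^ m * f r ^ 2 *
      (((m : ℝ) + 1) ^ 2 / 4)) (Icc 0 1) :=
    Continuous.integrableOn_Icc (by fun_prop)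
  have h2 := integrableOn_mul_sum_YY_sq hD k (g := fun r => r ^ m * f r ^ 2 / 4) (by fun_prop)
  refine (h1.sub h2).congr (.of_forall fun r => ?_)
  simp only [hardyDensity, Pi.sub_apply]
  ring

lemma sub_le_integral_hardyDensity (m : ℕ) {D : ℝ} (hD : 1 ≤ D) (k : ℕ) {c : ℝ} (hc : c ^ 2 = c)
    {f f' : ℝ → ℝ} {a b : ℝ} (hf : ∀ r, HasDerivAt f (f' r) r) (hf' : Continuous f')
    (ha : 0 ≤ a) (hab : a ≤ b) (hb : b ≤ 1) :
    b ^ (m + 1) * (f b ^ 2 * (-(ZZ k (b / D) / 2 + c * YY (k + 1) (b / D)) - (m + 1) / 2)) -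
      a ^ (m + 1) * (f a ^ 2 * (-(ZZ k (a / D) / 2 + c * YY (k + 1) (a / D)) - (m + 1) / 2))
      ≤ ∫ r in a..b, hardyDensity m D k f f' r := by
  have hfc : Continuous f := continuous_iff_continuousAt.2 fun r => (hf r).continuousAt
  refine sub_le_integral_of_riccati m (Q := fun r => ∑ i ∈ Finset.Icc 1 k, YY i (r / D) ^ 2)
    (S := fun r => -(ZZ k (r / D) / 2 + c * YY (k + 1) (r / D))) (M := k / 2 + |c|)
    hf ha hab hb (fun r hr => riccati_ZZ_add_YY hD k hc hr) ?_
    ((integrableOn_hardyDensity m hD k hfc hf').mono_set (Icc_subset_Icc ha hb))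
  intro r hr
  have hZ := ZZ_mem_Icc (div_mem_Ioc hr hD) k
  have hY := YY_mem_Ioc (div_mem_Ioc hr hD) (k + 1)
  rw [abs_neg]
  refine (abs_add_le _ _).trans (add_le_add ?_ ?_)
  · rw [abs_of_nonneg (by linarith [hZ.1])]
    linarith [hZ.2]
  · rw [abs_mul, abs_of_pos hY.1]
    exact mul_le_of_le_one_right (abs_nonneg c) hY.2

lemma integral_hardyDensity_nonneg (m : ℕ) {D : ℝ} (hD : 1 ≤ D) (k : ℕ) {f f' : ℝ → ℝ}
    (hf : ∀ r, HasDerivAt f (f' r) r) (hf' : Continuous f') (hf1 : f 1 = 0) :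
    0 ≤ ∫ r in (0 : ℝ)..1, hardyDensity m D k f f' r := by
  simpa [hf1] using sub_le_integral_hardyDensity m hD k (c := 0) (by norm_num) hf hf' le_rfl
    zero_le_one le_rfl

lemma integral_YY_sq_le (m : ℕ) {D : ℝ} (hD : 1 ≤ D) (k : ℕ) {f f' : ℝ → ℝ}
    (hf : ∀ r, HasDerivAt f (f' r) r) (hf' : Continuous f') (hf1 : f 1 = 0) :
    IntegrableOn (fun r => r ^ m * f r ^ 2 * YY (k + 1) (r / D) ^ 2) (Icc 0 1) ∧
      ∫ r in (0 : ℝ)..1, r ^ m * f r ^ 2 * YY (k + 1) (r / D) ^ 2 ≤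
        4 * ∫ r in (0 : ℝ)..1, hardyDensity m D k f f' r := by
  have hfc : Continuous f := continuous_iff_continuousAt.2 fun r => (hf r).continuousAt
  have hk := integrableOn_hardyDensity m hD k hfc hf'
  have hk' := integrableOn_hardyDensity m hD (k + 1) hfc hf'
  have heq : (fun r => r ^ m * f r ^ 2 * YY (k + 1) (r / D) ^ 2) = fun r =>
      4 * (hardyDensity m D k f f' r - hardyDensity m D (k + 1) f f' r) := by
    ext r
    rw [hardyDensity, hardyDensity, Finset.sum_Icc_succ_top (by omega)]
    ring
  rw [heq]
  refine ⟨(hk.sub hk').const_mul 4, ?_⟩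
  rw [intervalIntegral.integral_const_mul, intervalIntegral.integral_sub]
  · linarith [integral_hardyDensity_nonneg m hD (k + 1) hf hf' hf1]
  · exact (intervalIntegrable_iff_integrableOn_Icc_of_le zero_le_one).2 hk
  · exact (intervalIntegrable_iff_integrableOn_Icc_of_le zero_le_one).2 hk'

lemma pow_mul_sq_mul_YY_le (m : ℕ) {D : ℝ} (hD : 1 ≤ D) (k : ℕ) {f f' : ℝ → ℝ}
    (hf : ∀ r, HasDerivAt f (f' r) r) (hf' : Continuous f') (hf1 : f 1 = 0)
    {r : ℝ} (hr : r ∈ Ioc (0 : ℝ) 1) :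
    r ^ (m + 1) * f r ^ 2 * YY (k + 1) (r / D) ≤
      ∫ r in (0 : ℝ)..1, hardyDensity m D k f f' r := by
  have hfc : Continuous f := continuous_iff_continuousAt.2 fun r => (hf r).continuousAt
  have hk := integrableOn_hardyDensity m hD k hfc hf'
  have hleft := sub_le_integral_hardyDensity m hD k (c := 0) (by norm_num) hf hf' le_rfl
    hr.1.le hr.2
  have hright := sub_le_integral_hardyDensity m hD k (c := 1) (by norm_num) hf hf' hr.1.le
    hr.2 le_rfl
  rw [← intervalIntegral.integral_add_adjacent_intervals (b := r)
    ((intervalIntegrable_iff_integrableOn_Icc_of_le hr.1.le).2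
      (hk.mono_set (Icc_subset_Icc le_rfl hr.2)))
    ((intervalIntegrable_iff_integrableOn_Icc_of_le hr.2).2
      (hk.mono_set (Icc_subset_Icc hr.1.le le_rfl)))]
  rw [hf1] at hright
  rw [zero_pow (Nat.succ_ne_zero m)] at hleft
  linarith

lemma integral_rpow_le (m : ℕ) {D : ℝ} (hD : 1 ≤ D) (k : ℕ) {f f' : ℝ → ℝ}
    (hf : ∀ r, HasDerivAt f (f' r) r) (hf' : Continuous f') (hf1 : f 1 = 0)
    {s β : ℝ} (hs : 1 ≤ s) (hβ : m + 3 + β = (m + 1) * s) :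
    ∫ r in (0 : ℝ)..1, r ^ (m + 2) * (r ^ β * YY (k + 1) (r / D) ^ (1 + s) * |f r| ^ (2 * s)) ≤
      4 * (∫ r in (0 : ℝ)..1, hardyDensity m D k f f' r) ^ s := by
  obtain ⟨hint, hle⟩ := integral_YY_sq_le m hD k hf hf' hf1
  set E := ∫ r in (0 : ℝ)..1, hardyDensity m D k f f' r with hE
  have hE0 : 0 ≤ E := integral_hardyDensity_nonneg m hD k hf hf' hf1
  have hpt : ∀ r ∈ Ioc (0 : ℝ) 1,
      r ^ (m + 2) * (r ^ β * YY (k + 1) (r / D) ^ (1 + s) * |f r| ^ (2 * s)) ≤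
        r ^ m * f r ^ 2 * YY (k + 1) (r / D) ^ 2 * E ^ (s - 1) := by
    intro r hr
    have hY : 0 < YY (k + 1) (r / D) := (YY_mem_Ioc (div_mem_Ioc hr hD) (k + 1)).1
    have hb := pow_mul_sq_mul_YY_le m hD k hf hf' hf1 hr
    set Y := YY (k + 1) (r / D)
    have hr0 : 0 < r := hr.1
    have hfac : r ^ (m + 2) * (r ^ β * Y ^ (1 + s) * |f r| ^ (2 * s)) =
        r ^ m * f r ^ 2 * Y ^ 2 * (r ^ (m + 1) * f r ^ 2 * Y) ^ (s - 1) := by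
      rcases eq_or_ne (f r) 0 with h0 | h0
      · simp [h0, zero_rpow (show 2 * s ≠ 0 by linarith)]
      · have ha : 0 < |f r| := abs_pos.2 h0
        rw [← sq_abs (f r), mul_rpow (by positivity) hY.le, mul_rpow (by positivity) (by positivity),
          ← rpow_natCast r m, ← rpow_natCast r (m + 1), ← rpow_natCast r (m + 2),
          ← rpow_natCast |f r| 2, ← rpow_natCast Y 2, ← rpow_mul hr0.le, ← rpow_mul ha.le]
        have e1 : r ^ ((m + 2 : ℕ) : ℝ) * r ^ β =
            r ^ (m : ℝ) * r ^ (((m + 1 : ℕ) : ℝ) * (s - 1)) := by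
          rw [← rpow_add hr0, ← rpow_add hr0]
          congr 1
          push_cast
          linarith
        have e2 : Y ^ (1 + s) = Y ^ ((2 : ℕ) : ℝ) * Y ^ (s - 1) := by
          rw [← rpow_add hY]
          congr 1
          push_cast
          ring
        have e3 : |f r| ^ (2 * s) = |f r| ^ ((2 : ℕ) : ℝ) * |f r| ^ (((2 : ℕ) : ℝ) * (s - 1)) := by
          rw [← rpow_add ha]
          congr 1
          push_cast
          ring
        rw [e2, e3]
        linear_combination
          (Y ^ ((2 : ℕ) : ℝ) * Y ^ (s - 1) *
            (|f r| ^ ((2 : ℕ) : ℝ) * |f r| ^ (((2 : ℕ) : ℝ) * (s - 1)))) * e1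
    rw [hfac]
    have := rpow_le_rpow (by positivity) hb (show 0 ≤ s - 1 by linarith)
    gcongr
  have hEs : E * E ^ (s - 1) = E ^ s := by
    rw [← rpow_one_add' hE0 (by linarith)]
    ring_nf
  calc ∫ r in (0 : ℝ)..1, r ^ (m + 2) * (r ^ β * YY (k + 1) (r / D) ^ (1 + s) * |f r| ^ (2 * s))
      ≤ ∫ r in (0 : ℝ)..1, r ^ m * f r ^ 2 * YY (k + 1) (r / D) ^ 2 * E ^ (s - 1) := by
        rw [intervalIntegral.integral_of_le zero_le_one, intervalIntegral.integral_of_le zero_le_one]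
        refine integral_mono_of_nonneg ?_ ?_ ?_
        · refine (ae_restrict_iff' measurableSet_Ioc).2 (.of_forall fun r hr => ?_)
          have hY := (YY_mem_Ioc (div_mem_Ioc hr hD) (k + 1)).1
          have hr0 := hr.1
          simp only [Pi.zero_apply]
          positivity
        · exact (hint.mono_set Ioc_subset_Icc_self).mul_const _
        · exact (ae_restrict_iff' measurableSet_Ioc).2 (.of_forall hpt)
    _ = (∫ r in (0 : ℝ)..1, r ^ m * f r ^ 2 * YY (k + 1) (r / D) ^ 2) * E ^ (s - 1) :=
        intervalIntegral.integral_mul_const _ _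
    _ ≤ 4 * E * E ^ (s - 1) := by gcongr
    _ = 4 * E ^ s := by rw [mul_assoc, hEs]

lemma hardy_functional_eq_integral_hardyDensity (m : ℕ) {D : ℝ} (hD : 1 ≤ D) (k : ℕ)
    {ζ : EuclideanSpace ℝ (Fin (m + 3)) → ℝ} {f : ℝ → ℝ} (hζ : ∀ x, ζ x = f ‖x‖)
    (hf : ContDiff ℝ 1 f) :
    (∫ x in Metric.ball (0 : EuclideanSpace ℝ (Fin (m + 3))) 1, ‖fderiv ℝ ζ x‖ ^ 2)
        - (((m : ℝ) + 1) / 2) ^ 2 *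
          (∫ x in Metric.ball (0 : EuclideanSpace ℝ (Fin (m + 3))) 1, |ζ x| ^ 2 / ‖x‖ ^ 2)
        - (1 / 4) * (∫ x in Metric.ball (0 : EuclideanSpace ℝ (Fin (m + 3))) 1,
          (|ζ x| ^ 2 / ‖x‖ ^ 2) * ∑ i ∈ Finset.Icc 1 k, (YY i (‖x‖ / D)) ^ 2) =
      ((m + 3) * volume.real (Metric.ball (0 : EuclideanSpace ℝ (Fin (m + 3))) 1)) *
        ∫ r in (0 : ℝ)..1, hardyDensity m D k f (deriv f) r := by
  have hfc := hf.continuous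
  have hf'c : Continuous (deriv f) := hf.continuous_deriv le_rfl
  have hgrad : ∫ x in Metric.ball (0 : EuclideanSpace ℝ (Fin (m + 3))) 1, ‖fderiv ℝ ζ x‖ ^ 2 =
      ∫ x in Metric.ball (0 : EuclideanSpace ℝ (Fin (m + 3))) 1, (fun r => deriv f r ^ 2) ‖x‖ := by
    refine integral_congr_ae (ae_restrict_of_ae ?_)
    filter_upwards [Measure.ae_ne volume (0 : EuclideanSpace ℝ (Fin (m + 3)))] with x hx
    rw [norm_fderiv_of_eq_comp_norm hζ (hf.differentiable (by norm_num)) hx, sq_abs]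
  simp only [hζ]
  rw [hgrad, setIntegral_ball_fun_norm m (fun r => deriv f r ^ 2),
    setIntegral_ball_fun_norm m (fun r => |f r| ^ 2 / r ^ 2),
    setIntegral_ball_fun_norm m
      (fun r => |f r| ^ 2 / r ^ 2 * ∑ i ∈ Finset.Icc 1 k, (YY i (r / D)) ^ 2)]
  have e1 : ∫ r in (0 : ℝ)..1, r ^ (m + 2) * (|f r| ^ 2 / r ^ 2) =
      ∫ r in (0 : ℝ)..1, r ^ m * f r ^ 2 := by
    refine intervalIntegral.integral_congr_ae (.of_forall fun r hr => ?_)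
    rw [uIoc_of_le zero_le_one] at hr
    have := hr.1.ne'
    rw [sq_abs]
    field_simp
    ring
  have e2 : ∫ r in (0 : ℝ)..1, r ^ (m + 2) *
        (|f r| ^ 2 / r ^ 2 * ∑ i ∈ Finset.Icc 1 k, (YY i (r / D)) ^ 2) =
      ∫ r in (0 : ℝ)..1, r ^ m * f r ^ 2 * ∑ i ∈ Finset.Icc 1 k, (YY i (r / D)) ^ 2 := by
    refine intervalIntegral.integral_congr_ae (.of_forall fun r hr => ?_)
    rw [uIoc_of_le zero_le_one] at hr
    have := hr.1.ne'
    rw [sq_abs]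
    field_simp
    ring
  have i1 : IntervalIntegrable (fun r => r ^ (m + 2) * deriv f r ^ 2) volume 0 1 :=
    Continuous.intervalIntegrable (by fun_prop) _ _
  have i2 : IntervalIntegrable (fun r => r ^ m * f r ^ 2) volume 0 1 :=
    Continuous.intervalIntegrable (by fun_prop) _ _
  have i3 : IntervalIntegrable
      (fun r => r ^ m * f r ^ 2 * ∑ i ∈ Finset.Icc 1 k, (YY i (r / D)) ^ 2) volume 0 1 :=
    (intervalIntegrable_iff_integrableOn_Icc_of_le zero_le_one).2
      (integrableOn_mul_sum_YY_sq hD k (by fun_prop))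
  have e3 : hardyDensity m D k f (deriv f) = fun r =>
      r ^ (m + 2) * deriv f r ^ 2 - (((m : ℝ) + 1) / 2) ^ 2 * (r ^ m * f r ^ 2)
        - (1 / 4) * (r ^ m * f r ^ 2 * ∑ i ∈ Finset.Icc 1 k, (YY i (r / D)) ^ 2) := by
    ext r
    rw [hardyDensity]
    ring
  rw [e1, e2, e3, intervalIntegral.integral_sub (i1.sub (i2.const_mul _)) (i3.const_mul _),
    intervalIntegral.integral_sub i1 (i2.const_mul _), intervalIntegral.integral_const_mul,
    intervalIntegral.integral_const_mul]
  ring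

/-- Radial improvement of the series `L^2`-Hardy inequality (Lemma 4.1 of the paper). -/
theorem radial_L2_series_improvement (n : ℕ) (hn : 2 ≤ n) (p : ℝ) (hp2 : 2 ≤ p)
    (hpn : p < n) (pstar : ℝ) (hps : pstar = n * p / (n - p)) :
    ∃ C : ℝ, 0 < C ∧
      ∀ (D : ℝ), 1 ≤ D → ∀ (k : ℕ),
        ∀ ζ : EuclideanSpace ℝ (Fin n) → ℝ,
          ContDiff ℝ (⊤ : ℕ∞) ζ → HasCompactSupport ζ →
          tsupport ζ ⊆ Metric.ball (0 : EuclideanSpace ℝ (Fin n)) 1 →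
          (∀ x y : EuclideanSpace ℝ (Fin n), ‖x‖ = ‖y‖ → ζ x = ζ y) →
          (∫ x in Metric.ball (0 : EuclideanSpace ℝ (Fin n)) 1, ‖fderiv ℝ ζ x‖ ^ (2 : ℕ))
            - (((n : ℝ) - 2) / 2) ^ (2 : ℕ) *
              (∫ x in Metric.ball (0 : EuclideanSpace ℝ (Fin n)) 1, |ζ x| ^ (2 : ℕ) / ‖x‖ ^ (2 : ℕ))
            - (1 / 4) * (∫ x in Metric.ball (0 : EuclideanSpace ℝ (Fin n)) 1,
                (|ζ x| ^ (2 : ℕ) / ‖x‖ ^ (2 : ℕ)) * ∑ i ∈ Finset.Icc 1 k, (YY i (‖x‖ / D)) ^ 2)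
          ≥ C * (∫ x in Metric.ball (0 : EuclideanSpace ℝ (Fin n)) 1,
              ‖x‖ ^ (pstar * (p - 2) / p) * (YY (k + 1) (‖x‖ / D)) ^ (1 + pstar / p) *
                |ζ x| ^ (2 * pstar / p)) ^ (p / pstar) := by
  obtain ⟨m, rfl⟩ : ∃ m, n = m + 3 := by
    have : (2 : ℝ) < n := hp2.trans_lt hpn
    have : 2 < n := by exact_mod_cast this
    exact ⟨n - 3, by omega⟩
  have hnp : (0 : ℝ) < (m + 3 : ℕ) - p := by linarith
  have hp0 : 0 < p := by linarith
  set s := pstar / p with hs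
  have hs' : s = (m + 3 : ℕ) / ((m + 3 : ℕ) - p) := by
    rw [hs, hps]
    field_simp
  have hs1 : 1 ≤ s := by
    rw [hs', le_div_iff₀ hnp]
    linarith
  have hβ : (m : ℝ) + 3 + pstar * (p - 2) / p = (m + 1) * s := by
    have h1 : s * ((m + 3 : ℕ) - p) = (m + 3 : ℕ) := by
      rw [hs']
      field_simp
    have h2 : pstar * (p - 2) / p = s * (p - 2) := by
      rw [hs]
      ring
    push_cast at h1
    linarith
  have h2s : 2 * pstar / p = 2 * s := by
    rw [hs]
    ring
  have hinv : p / pstar = s⁻¹ := by rw [hs, inv_div]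
  rw [h2s, hinv]
  set c : ℝ := (m + 3) * volume.real (Metric.ball (0 : EuclideanSpace ℝ (Fin (m + 3))) 1) with hc
  have hc0 : 0 < c :=
    mul_pos (by positivity)
      (ENNReal.toReal_pos (Metric.measure_ball_pos _ _ one_pos).ne' measure_ball_lt_top.ne)
  refine ⟨c / (4 * c) ^ s⁻¹, by positivity, fun D hD k ζ hζ _ hsupp hrad => ?_⟩
  set e : EuclideanSpace ℝ (Fin (m + 3)) := EuclideanSpace.single 0 1 with he
  have he1 : ‖e‖ = 1 := by simp [he]
  set f : ℝ → ℝ := fun r => ζ (r • e) with hf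
  have hζf : ∀ x, ζ x = f ‖x‖ := fun x => hrad _ _ (by simp [norm_smul, he1])
  have hfC : ContDiff ℝ 1 f := (hζ.of_le (by exact_mod_cast le_top)).comp (by fun_prop)
  have hf1 : f 1 = 0 := by
    refine image_eq_zero_of_notMem_tsupport (f := ζ) fun h => ?_
    simpa [he1] using hsupp h
  have hder : ∀ r, HasDerivAt f (deriv f r) r := fun r =>
    (hfC.differentiable (by norm_num) r).hasDerivAt
  have hder' : Continuous (deriv f) := hfC.continuous_deriv le_rfl
  have hlhs := hardy_functional_eq_integral_hardyDensity m hD k hζf hfC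
  rw [← hc] at hlhs
  rw [show (((m + 3 : ℕ) : ℝ) - 2) = m + 1 by push_cast; ring, hlhs]
  have hrhs := integral_rpow_le m hD k hder hder' hf1 hs1 hβ
  have hE0 := integral_hardyDensity_nonneg m hD k hder hder' hf1
  set E := ∫ r in (0 : ℝ)..1, hardyDensity m D k f (deriv f) r
  have hnonneg : 0 ≤ ∫ x in Metric.ball (0 : EuclideanSpace ℝ (Fin (m + 3))) 1,
      ‖x‖ ^ (pstar * (p - 2) / p) * YY (k + 1) (‖x‖ / D) ^ (1 + s) * |ζ x| ^ (2 * s) := by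
    refine integral_nonneg_of_ae ((ae_restrict_iff' Metric.isOpen_ball.measurableSet).2 ?_)
    filter_upwards [Measure.ae_ne volume (0 : EuclideanSpace ℝ (Fin (m + 3)))] with x hx hx1
    have hY := (YY_mem_Ioc (div_mem_Ioc ⟨norm_pos_iff.2 hx, (mem_ball_zero_iff.1 hx1).le⟩ hD)
      (k + 1)).1
    simp only [Pi.zero_apply]
    positivity
  have hle : ∫ x in Metric.ball (0 : EuclideanSpace ℝ (Fin (m + 3))) 1,
      ‖x‖ ^ (pstar * (p - 2) / p) * YY (k + 1) (‖x‖ / D) ^ (1 + s) * |ζ x| ^ (2 * s)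
        ≤ 4 * c * E ^ s := by
    simp only [hζf]
    rw [setIntegral_ball_fun_norm m
      (fun r => r ^ (pstar * (p - 2) / p) * YY (k + 1) (r / D) ^ (1 + s) * |f r| ^ (2 * s)), ← hc]
    calc _ ≤ c * (4 * E ^ s) := by gcongr
      _ = 4 * c * E ^ s := by ring
  have hpow := rpow_le_rpow hnonneg hle (show 0 ≤ s⁻¹ by positivity)
  rw [mul_rpow (by positivity) (by positivity), rpow_rpow_inv hE0 (by linarith)] at hpow
  calc _ ≤ c / (4 * c) ^ s⁻¹ * ((4 * c) ^ s⁻¹ * E) := by gcongr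
    _ = c * E := by field_simp
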